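/- For all real numbers s with 0 ≤ s < 1/2, all x > 4s, and all y > 0, one has β(x-4s, y) · β(x+4s, y) ≤ (β(x,y))² · ((1+4s)x/(x-4s)). -/

import Mathlib

open MeasureTheory

/-- `β(x,y) = ∫_{-π/2}^{π/2} (cos t)^{x-1} e^{yt} dt`. -/
noncomputable def beta (x y : ℝ) : ℝ :=
  ∫ t in (-(Real.pi / 2))..(Real.pi / 2), (Real.cos t) ^ (x - 1) * Real.exp (y * t)

theorem hasDerivAt_cos_rpow_mul_exp {x y t : ℝ} (ht : 0 < Real.cos t) :
    HasDerivAt (fun t => -((x + 1) * (Real.cos t ^ x * Real.sin t * Real.exp (y * t)) +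
        y * (Real.cos t ^ (x + 1) * Real.exp (y * t))))
      (x * (x + 1) * (Real.cos t ^ (x - 1) * Real.exp (y * t)) -
        ((x + 1) ^ 2 + y ^ 2) * (Real.cos t ^ (x + 2 - 1) * Real.exp (y * t))) t := by
  have he : HasDerivAt (fun t => Real.exp (y * t)) (Real.exp (y * t) * (y * 1)) t :=
    ((hasDerivAt_id t).const_mul y).exp
  have hc (p : ℝ) := (Real.hasDerivAt_cos t).rpow_const (p := p) (Or.inl ht.ne')
  have h := (((((hc x).mul (Real.hasDerivAt_sin t)).mul he).const_mul (x + 1)).add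
    (((hc (x + 1)).mul he).const_mul y)).neg
  refine h.congr_deriv ?_
  have h1 : Real.cos t ^ x = Real.cos t ^ (x - 1) * Real.cos t := by
    rw [← Real.rpow_add_one ht.ne', sub_add_cancel]
  have h2 : Real.cos t ^ (x + 1) = Real.cos t ^ (x - 1) * Real.cos t * Real.cos t := by
    rw [Real.rpow_add_one ht.ne', h1]
  have h3 : x + 2 - 1 = x + 1 := by ring
  have h4 : x + 1 - 1 = x := by ring
  simp only [Pi.mul_apply]
  rw [h3, h4, h2, h1]
  linear_combination (x * (x + 1) * Real.cos t ^ (x - 1) * Real.exp (y * t)) *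
    Real.sin_sq_add_cos_sq t

theorem continuous_cos_rpow_mul_exp {p : ℝ} (hp : 0 ≤ p) (y : ℝ) :
    Continuous fun t => Real.cos t ^ p * Real.exp (y * t) :=
  (Real.continuous_cos.rpow_const fun _ => Or.inr hp).mul (by fun_prop)

theorem continuous_beta_primitive {x : ℝ} (hx : 0 < x) (y : ℝ) :
    Continuous (fun t => -((x + 1) * (Real.cos t ^ x * Real.sin t * Real.exp (y * t)) +
        y * (Real.cos t ^ (x + 1) * Real.exp (y * t)))) := by
  have h1 : Continuous fun t => Real.cos t ^ x :=
    Real.continuous_cos.rpow_const fun _ => Or.inr hx.le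
  have h2 := continuous_cos_rpow_mul_exp (p := x + 1) (by linarith) y
  fun_prop

theorem intervalIntegrable_cos_rpow_mul_exp {x : ℝ} (hx : 0 < x) (y : ℝ) :
    IntervalIntegrable (fun t => Real.cos t ^ (x - 1) * Real.exp (y * t)) volume
      (-(Real.pi / 2)) (Real.pi / 2) := by
  have hcont := continuous_cos_rpow_mul_exp (p := x + 2 - 1) (by linarith) y
  obtain ⟨M, hM⟩ := (isCompact_Icc (a := -(Real.pi / 2)) (b := Real.pi / 2)).bddAbove_image
    (hcont.const_mul ((x + 1) ^ 2 + y ^ 2)).continuousOn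
  have hpi := Real.pi_pos
  have hint := intervalIntegral.intervalIntegrable_deriv_of_nonneg
    (a := -(Real.pi / 2)) (b := Real.pi / 2)
    (g := fun t => -((x + 1) * (Real.cos t ^ x * Real.sin t * Real.exp (y * t)) +
        y * (Real.cos t ^ (x + 1) * Real.exp (y * t))) + M * t)
    (g' := fun t => x * (x + 1) * (Real.cos t ^ (x - 1) * Real.exp (y * t)) -
        ((x + 1) ^ 2 + y ^ 2) * (Real.cos t ^ (x + 2 - 1) * Real.exp (y * t)) + M)
    ((continuous_beta_primitive hx y).add (by fun_prop)).continuousOn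
    (fun t ht => by
      rw [min_eq_left (by linarith), max_eq_right (by linarith)] at ht
      exact (hasDerivAt_cos_rpow_mul_exp (Real.cos_pos_of_mem_Ioo ht)).add
        (((hasDerivAt_id t).const_mul M).congr_deriv (mul_one M)))
    (fun t ht => by
      rw [min_eq_left (by linarith), max_eq_right (by linarith)] at ht
      have hc := Real.cos_pos_of_mem_Ioo ht
      have := hM (Set.mem_image_of_mem _ (Set.Ioo_subset_Icc_self ht))
      have : 0 ≤ x * (x + 1) * (Real.cos t ^ (x - 1) * Real.exp (y * t)) := by positivity
      linarith)
  have h := ((hint.sub (intervalIntegrable_const (c := M))).add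
    ((hcont.const_mul ((x + 1) ^ 2 + y ^ 2)).intervalIntegrable _ _)).const_mul
      (x * (x + 1))⁻¹
  refine h.congr_ae (.of_forall fun t => ?_)
  simp only
  field_simp
  ring

theorem beta_add_two {x : ℝ} (hx : 0 < x) (y : ℝ) :
    ((x + 1) ^ 2 + y ^ 2) * beta (x + 2) y = x * (x + 1) * beta x y := by
  have hpi := Real.pi_pos
  have h1 := (intervalIntegrable_cos_rpow_mul_exp hx y).const_mul (x * (x + 1))
  have h2 := (intervalIntegrable_cos_rpow_mul_exp (x := x + 2) (by linarith) y).const_mul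
    ((x + 1) ^ 2 + y ^ 2)
  have h := intervalIntegral.integral_eq_sub_of_hasDerivAt_of_le (by linarith)
    (continuous_beta_primitive hx y).continuousOn
    (fun t ht => hasDerivAt_cos_rpow_mul_exp (Real.cos_pos_of_mem_Ioo ht)) (h1.sub h2)
  rw [intervalIntegral.integral_sub h1 h2, intervalIntegral.integral_const_mul,
    intervalIntegral.integral_const_mul] at h
  simp only [Real.cos_neg, Real.cos_pi_div_two, Real.zero_rpow hx.ne',
    Real.zero_rpow (show x + 1 ≠ 0 by linarith)] at h
  unfold beta
  linarith

theorem beta_pos {x : ℝ} (hx : 0 < x) (y : ℝ) : 0 < beta x y :=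
  intervalIntegral.intervalIntegral_pos_of_pos_on (intervalIntegrable_cos_rpow_mul_exp hx y)
    (fun t ht => by have := Real.cos_pos_of_mem_Ioo ht; positivity)
    (by linarith [Real.pi_pos])

theorem beta_add_le {x a l : ℝ} (hx : 0 < x) (ha : 0 ≤ a) (ha2 : a ≤ 2) (hl : 0 < l) (y : ℝ) :
    beta (x + a) y ≤ l ^ a * ((1 - a / 2) * beta x y + a / 2 / l ^ 2 * beta (x + 2) y) := by
  have hpi := Real.pi_pos
  have h0 := intervalIntegrable_cos_rpow_mul_exp (x := x + a) (by linarith) y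
  have h1 := (intervalIntegrable_cos_rpow_mul_exp hx y).const_mul (1 - a / 2)
  have h2 := (intervalIntegrable_cos_rpow_mul_exp (x := x + 2) (by linarith) y).const_mul
    (a / 2 / l ^ 2)
  unfold beta
  rw [← intervalIntegral.integral_const_mul, ← intervalIntegral.integral_const_mul,
    ← intervalIntegral.integral_add h1 h2, ← intervalIntegral.integral_const_mul]
  refine intervalIntegral.integral_mono_on_of_le_Ioo (by linarith) h0
    ((h1.add h2).const_mul (l ^ a)) fun t ht => ?_
  have hc := Real.cos_pos_of_mem_Ioo ht
  have hamgm := Real.geom_mean_le_arith_mean2_weighted (w₁ := 1 - a / 2) (w₂ := a / 2)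
    (p₁ := 1) (p₂ := (Real.cos t / l) ^ 2) (by linarith) (by linarith) zero_le_one
    (by positivity) (by ring)
  rw [Real.one_rpow, one_mul, ← Real.rpow_natCast, ← Real.rpow_mul (by positivity),
    show ((2 : ℕ) : ℝ) * (a / 2) = a by push_cast; ring, Real.rpow_natCast,
    Real.div_rpow hc.le hl.le, div_le_iff₀ (by positivity)] at hamgm
  rw [show x + a - 1 = x - 1 + a by ring, show x + 2 - 1 = x - 1 + (2 : ℕ) by push_cast; ring,
    Real.rpow_add hc, Real.rpow_add hc, Real.rpow_natCast]
  calc Real.cos t ^ (x - 1) * Real.cos t ^ a * Real.exp (y * t)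
      = Real.cos t ^ a * (Real.cos t ^ (x - 1) * Real.exp (y * t)) := by ring
    _ ≤ _ := mul_le_mul_of_nonneg_right hamgm (by positivity)
    _ = _ := by ring

theorem beta_mul_beta_le {x a : ℝ} (hx : 0 < x) (ha : 0 ≤ a) (ha2 : a ≤ 2) (y : ℝ) :
    beta (x + a) y * beta (x + (2 - a)) y ≤ beta x y * beta (x + 2) y := by
  have hb := beta_pos hx y
  have hb2 := beta_pos (x := x + 2) (by linarith) y
  obtain ⟨l, hl, hl2⟩ : ∃ l > 0, l ^ 2 = beta (x + 2) y / beta x y :=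
    ⟨√(beta (x + 2) y / beta x y), by positivity, Real.sq_sqrt (by positivity)⟩
  have hlb : beta (x + 2) y = l ^ 2 * beta x y := by rw [hl2]; field_simp
  have key {c : ℝ} (hc : 0 ≤ c) (hc2 : c ≤ 2) : beta (x + c) y ≤ l ^ c * beta x y := by
    have h := beta_add_le hx hc hc2 hl y
    rw [hlb] at h
    refine h.trans_eq ?_
    field_simp
    ring
  calc _ ≤ l ^ a * beta x y * (l ^ (2 - a) * beta x y) :=
        mul_le_mul (key ha ha2) (key (by linarith) (by linarith))
          (beta_pos (by linarith) y).le (by positivity)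
    _ = l ^ a * l ^ (2 - a) * beta x y ^ 2 := by ring
    _ = _ := by
      rw [← Real.rpow_add hl, add_sub_cancel, Real.rpow_two, hlb]
      ring

theorem beta_normalized_bound (x y s : ℝ) (hs0 : 0 ≤ s) (hs : s < 1 / 2)
    (hx : 4 * s < x) (hy : 0 < y) :
    beta (x - 4 * s) y * beta (x + 4 * s) y ≤
      (beta x y) ^ 2 * ((1 + 4 * s) * x / (x - 4 * s)) := by
  obtain ⟨a, ha⟩ : ∃ a, a = 4 * s := ⟨_, rfl⟩
  rw [← ha] at hx ⊢
  have ha0 : 0 ≤ a := by linarith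
  have hx0 : 0 < x := by linarith
  have hu : 0 < x - a := by linarith
  have hb := beta_pos hx0 y
  have h1 := beta_mul_beta_le hx0 ha0 (by linarith) y
  have h2 := beta_add_two hx0 y
  have h3 := beta_add_two hu y
  rw [show x - a + 2 = x + (2 - a) by ring] at h3
  have hminus : beta (x - a) y =
      ((x - a + 1) ^ 2 + y ^ 2) * beta (x + (2 - a)) y / ((x - a) * (x - a + 1)) := by
    rw [h3]; field_simp
  have hplus : beta (x + 2) y = x * (x + 1) * beta x y / ((x + 1) ^ 2 + y ^ 2) := by
    rw [← h2]; field_simp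
  have hsq : (x - a + 1) ^ 2 + y ^ 2 ≤ (x + 1) ^ 2 + y ^ 2 := by
    gcongr
    linarith
  calc beta (x - a) y * beta (x + a) y
      = ((x - a + 1) ^ 2 + y ^ 2) / ((x - a) * (x - a + 1)) *
          (beta (x + a) y * beta (x + (2 - a)) y) := by rw [hminus]; ring
    _ ≤ ((x + 1) ^ 2 + y ^ 2) / ((x - a) * (x - a + 1)) * (beta x y * beta (x + 2) y) := by
        have := beta_pos (x := x + a) (by linarith) y
        have := beta_pos (x := x + (2 - a)) (by linarith) y
        gcongr
    _ = beta x y ^ 2 * (x * (x + 1) / (x - a + 1) / (x - a)) := by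
        rw [hplus]; field_simp
    _ ≤ _ := by
        gcongr
        rw [div_le_iff₀ (by linarith)]
        nlinarith [mul_nonneg (mul_nonneg hx0.le ha0) hu.le]
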